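/- arXiv:1905.11213 — 10 statements merged into one kernel-verified Lean document; each statement's English description precedes it below -/
import Mathlib

section
/- Let d ≥ 2, let ε₁, ε_∞ > 0 with ε_∞ < ε₁ < d·ε_∞, let p ∈ (1, ∞) with Hölder conjugate q (1/p + 1/q = 1), and set α = ε₁/ε_∞ − ⌊ε₁/ε_∞⌋. Then the infimum of ‖x‖_p over all x : Fin d → ℝ lying outside the convex hull C = convexHull ℝ (B₁ ∪ B_∞) equals ε₁ / (ε₁/ε_∞ − α + α^q)^(1/q). -/
open Finset

noncomputable def lpnorm {d : ℕ} (p : ℝ) (x : Fin d → ℝ) : ℝ :=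
  (∑ i, |x i| ^ p) ^ (1 / p)

noncomputable def l1norm {d : ℕ} (x : Fin d → ℝ) : ℝ := ∑ i, |x i|

noncomputable def linfnorm {d : ℕ} (x : Fin d → ℝ) : ℝ := ⨆ i, |x i|

lemma aux_convex {q a u : ℝ} (hq : 1 ≤ q) (ha0 : 0 ≤ a) (ha : a < 1) (hu : u ≤ 1)
    (hau : 1 ≤ a + u) : a ^ q + u ^ q ≤ 1 + (a + u - 1) ^ q := by
  have hb : 0 < 1 - (a + u - 1) := by linarith
  set b := a + u - 1 with hbdef
  have hc := (convexOn_rpow hq).2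
  have hbm : b ∈ Set.Ici (0:ℝ) := by simp only [Set.mem_Ici]; linarith
  have e1 := hc (x := 1) (by simp) (y := b) hbm
    (a := (1 - u) / (1 - b)) (b := (1 - a) / (1 - b))
    (div_nonneg (by linarith) hb.le) (div_nonneg (by linarith) hb.le)
    (by field_simp; linarith)
  have e2 := hc (x := 1) (by simp) (y := b) hbm
    (a := (1 - a) / (1 - b)) (b := (1 - u) / (1 - b))
    (div_nonneg (by linarith) hb.le) (div_nonneg (by linarith) hb.le)
    (by field_simp; linarith)
  have h1 : (1 - u) / (1 - b) + (1 - a) / (1 - b) = 1 := by field_simp; linarith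
  have f1 : ((1 - u) / (1 - b)) • (1:ℝ) + ((1 - a) / (1 - b)) • b = a := by
    simp only [smul_eq_mul]; field_simp; rw [hbdef]; ring
  have f2 : ((1 - a) / (1 - b)) • (1:ℝ) + ((1 - u) / (1 - b)) • b = u := by
    simp only [smul_eq_mul]; field_simp; rw [hbdef]; ring
  rw [f1] at e1
  rw [f2] at e2
  simp only [smul_eq_mul, Real.one_rpow] at e1 e2
  calc a ^ q + u ^ q ≤ ((1 - u) / (1 - b) + (1 - a) / (1 - b)) * (1 + b ^ q) := by linarith
    _ = _ := by rw [h1]; ring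

lemma aux_step {q t u : ℝ} (hq : 1 ≤ q) (hu0 : 0 ≤ u) (hu : u ≤ 1) :
    (⌊t⌋ : ℝ) + Int.fract t ^ q + u ^ q ≤ (⌊t + u⌋ : ℝ) + Int.fract (t + u) ^ q := by
  have ha0 := Int.fract_nonneg t
  have ha1 := Int.fract_lt_one t
  have hta := Int.floor_add_fract t
  by_cases h : Int.fract t + u < 1
  · have hf : ⌊t + u⌋ = ⌊t⌋ := by
      rw [Int.floor_eq_iff]; constructor <;> linarith
    have hf2 : Int.fract (t + u) = Int.fract t + u := by
      unfold Int.fract at *; rw [hf]; ring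
    rw [hf, hf2]
    have := Real.add_rpow_le_rpow_add ha0 hu0 hq
    linarith
  · push Not at h
    have hf : ⌊t + u⌋ = ⌊t⌋ + 1 := by
      rw [Int.floor_eq_iff]; push_cast; constructor <;> linarith
    have hf2 : Int.fract (t + u) = Int.fract t + u - 1 := by
      unfold Int.fract at *; rw [hf]; push_cast; ring
    rw [hf, hf2]
    have := aux_convex hq ha0 ha1 hu h
    push_cast
    linarith

lemma aux_sum {ι : Type*} {q : ℝ} (hq : 1 ≤ q) (u : ι → ℝ) (hu0 : ∀ i, 0 ≤ u i)
    (hu : ∀ i, u i ≤ 1) (S : Finset ι) :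
    ∑ i ∈ S, u i ^ q ≤ (⌊∑ i ∈ S, u i⌋ : ℝ) + Int.fract (∑ i ∈ S, u i) ^ q := by
  classical
  induction S using Finset.induction_on with
  | empty => simp; rw [Real.zero_rpow (by linarith)]
  | insert a S ha ih =>
    rw [Finset.sum_insert ha, Finset.sum_insert ha, add_comm (u a) (∑ i ∈ S, u i)]
    have := aux_step (t := ∑ i ∈ S, u i) hq (hu0 a) (hu a)
    linarith

lemma aux_mono {q t s : ℝ} (hq : 1 ≤ q) (h : t ≤ s) :
    (⌊t⌋ : ℝ) + Int.fract t ^ q ≤ (⌊s⌋ : ℝ) + Int.fract s ^ q := by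
  have a0 := Int.fract_nonneg t
  have a1 := Int.fract_lt_one t
  have b0 := Int.fract_nonneg s
  have hq0 : 0 ≤ q := by linarith
  rcases (Int.floor_mono h).eq_or_lt with e | e
  · have : Int.fract t ≤ Int.fract s := by
      unfold Int.fract; rw [e]; linarith
    rw [e]
    have := Real.rpow_le_rpow a0 this hq0
    linarith
  · have e' : ((⌊t⌋ + 1 : ℤ) : ℝ) ≤ ⌊s⌋ := by exact_mod_cast e
    push_cast at e'
    have := Real.rpow_le_one a0 a1.le hq0
    have := Real.rpow_nonneg b0 q
    linarith

lemma aux_range (A B : ℝ) (k d : ℕ) (h : k < d) :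
    ∑ i : Fin d, (if (i : ℕ) < k then A else if (i : ℕ) = k then B else 0) = k * A + B := by
  rw [Fin.sum_univ_eq_sum_range (fun i => if i < k then A else if i = k then B else 0) d]
  induction d, h using Nat.le_induction with
  | base =>
    rw [Finset.sum_range_succ, Finset.sum_congr rfl (g := fun _ => A)]
    · simp
    · intro i hi; simp [Finset.mem_range.1 hi]
  | succ n hn ih =>
    rw [Finset.sum_range_succ, ih]
    have h1 : ¬ n < k := by omega
    have h2 : n ≠ k := by omega
    simp [h1, h2]

lemma aux_linf {d : ℕ} (y : Fin d → ℝ) {e : ℝ} (h : linfnorm y ≤ e) (i : Fin d) : |y i| ≤ e :=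
  (le_ciSup (f := fun i => |y i|) (Set.finite_range _).bddAbove i).trans h

/-- Separation: a point outside the hull yields a dual certificate. -/
lemma aux_sep {d : ℕ} (hd : 2 ≤ d) {ε1 εinf : ℝ} (hε1 : 0 < ε1) (hεinf : 0 < εinf)
    (x : Fin d → ℝ)
    (hx : x ∉ convexHull ℝ ({y : Fin d → ℝ | l1norm y ≤ ε1} ∪
          {y : Fin d → ℝ | linfnorm y ≤ εinf})) :
    ∃ w : Fin d → ℝ, 0 < ∑ i, x i * w i ∧ (∀ i, ε1 * |w i| ≤ ∑ i, x i * w i) ∧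
      εinf * ∑ i, |w i| ≤ ∑ i, x i * w i := by
  have : Nonempty (Fin d) := ⟨⟨0, by omega⟩⟩
  set U1 : Set (Fin d → ℝ) := {y | l1norm y < ε1} with hU1
  set U2 : Set (Fin d → ℝ) := {y | ∀ i, |y i| < εinf} with hU2
  have o1 : IsOpen U1 := by
    apply isOpen_lt _ continuous_const
    unfold l1norm
    fun_prop
  have o2 : IsOpen U2 := by
    rw [hU2, Set.ofPred_forall]
    apply isOpen_iInter_of_finite
    intro i
    exact isOpen_lt (by fun_prop) continuous_const
  have hx' : x ∉ convexHull ℝ (U1 ∪ U2) := by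
    intro h
    apply hx
    refine convexHull_mono (Set.union_subset_union ?_ ?_) h
    · intro y (hy : l1norm y < ε1); exact le_of_lt (a := l1norm y) hy
    · intro y hy; exact ciSup_le fun i => (hy i).le
  obtain ⟨f, hf⟩ := geometric_hahn_banach_open_point (convex_convexHull ℝ (U1 ∪ U2))
    (o1.union o2).convexHull hx'
  let w : Fin d → ℝ := fun i => f (Pi.single i 1)
  have hfw : ∀ y, f y = ∑ i, y i * w i := by
    intro y
    have := LinearMap.pi_apply_eq_sum_univ (f : (Fin d → ℝ) →ₗ[ℝ] ℝ) y
    simp only [smul_eq_mul] at this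
    rw [← ContinuousLinearMap.coe_coe, this]
    refine Finset.sum_congr rfl fun i _ => ?_
    have h0 : (fun j => if i = j then (1:ℝ) else 0) = Pi.single i 1 := by
      ext j
      simp [Pi.single_apply, eq_comm]
    simp [w, h0]
  have hpos : 0 < f x := by
    have := hf 0 (subset_convexHull ℝ _ (Or.inr (by intro i; simpa using hεinf)))
    simpa using this
  have key : ∀ y, (∀ t : ℝ, 0 < t → t < 1 → t • y ∈ U1 ∪ U2) → f y ≤ f x := by
    intro y hy
    by_contra! hlt
    have hy0 : 0 < f y := hpos.trans hlt
    have := hf _ (subset_convexHull ℝ _ (hy (f x / f y) (by positivity) (by rwa [div_lt_one hy0])))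
    rw [map_smul, smul_eq_mul, div_mul_cancel₀ _ hy0.ne'] at this
    exact lt_irrefl _ this
  have hsgn : ∀ r : ℝ, |(SignType.sign r : ℝ)| ≤ 1 := by
    intro r
    rcases lt_trichotomy r 0 with h | h | h <;> simp [h]
  refine ⟨w, ?_, ?_, ?_⟩
  · rwa [← hfw]
  · intro i
    rw [← hfw x]
    have := key (Pi.single i (ε1 * (SignType.sign (w i) : ℝ))) ?_
    · rw [hfw] at this
      rw [Finset.sum_eq_single i] at this
      · rw [Pi.single_eq_same, mul_assoc, sign_mul_self] at this
        exact this
      · intro j _ hj; simp [hj]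
      · simp
    · intro t ht0 ht1
      left
      show ∑ j, |_| < ε1
      rw [Finset.sum_eq_single i]
      · simp only [Pi.smul_apply, Pi.single_eq_same, smul_eq_mul, abs_mul, abs_of_pos ht0,
          abs_of_pos hε1]
        have := hsgn (w i)
        have h3 : ε1 * |(SignType.sign (w i) : ℝ)| ≤ ε1 := by nlinarith
        have h4 : 0 ≤ ε1 * |(SignType.sign (w i) : ℝ)| := by positivity
        nlinarith
      · intro j _ hj; simp [hj]
      · simp
  · rw [← hfw x]
    have := key (fun i => εinf * (SignType.sign (w i) : ℝ)) ?_
    · rw [hfw] at this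
      simpa only [mul_assoc, sign_mul_self, ← Finset.mul_sum] using this
    · intro t ht0 ht1
      right
      intro i
      simp only [Pi.smul_apply, smul_eq_mul, abs_mul, abs_of_pos ht0, abs_of_pos hεinf]
      have := hsgn (w i)
      have h3 : εinf * |(SignType.sign (w i) : ℝ)| ≤ εinf := by nlinarith
      have h4 : 0 ≤ εinf * |(SignType.sign (w i) : ℝ)| := by positivity
      nlinarith

lemma aux_lower {d : ℕ} (hd : 2 ≤ d) {ε1 εinf : ℝ} (hε1 : 0 < ε1) (hεinf : 0 < εinf)
    {p q : ℝ} (hpq : p.HolderConjugate q)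
    (x : Fin d → ℝ)
    (hx : x ∉ convexHull ℝ ({y : Fin d → ℝ | l1norm y ≤ ε1} ∪
          {y : Fin d → ℝ | linfnorm y ≤ εinf})) :
    ε1 ≤ lpnorm p x * ((⌊ε1 / εinf⌋ : ℝ) + Int.fract (ε1 / εinf) ^ q) ^ (1 / q) := by
  obtain ⟨w, hM, hw1, hw2⟩ := aux_sep hd hε1 hεinf x hx
  set M := ∑ i, x i * w i with hMdef
  have hq1 : 1 < q := hpq.symm.lt
  let u : Fin d → ℝ := fun i => ε1 * |w i| / M
  have hu0 : ∀ i, 0 ≤ u i := fun i => by positivity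
  have hu1 : ∀ i, u i ≤ 1 := fun i => by
    show ε1 * |w i| / M ≤ 1
    rw [div_le_one hM]; exact hw1 i
  have hus : ∑ i, u i ≤ ε1 / εinf := by
    show ∑ i, ε1 * |w i| / M ≤ _
    rw [← Finset.sum_div, ← Finset.mul_sum, div_le_div_iff₀ hM hεinf]
    nlinarith
  have hN := (aux_sum hq1.le u hu0 hu1 Finset.univ).trans (aux_mono hq1.le hus)
  have hH := Real.inner_le_Lp_mul_Lq Finset.univ x (fun i => ε1 * w i / M) hpq
  have e1 : ∑ i, x i * (ε1 * w i / M) = ε1 := by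
    have : ∀ i, x i * (ε1 * w i / M) = ε1 / M * (x i * w i) := fun i => by ring
    simp only [this]
    rw [← Finset.mul_sum, ← hMdef, div_mul_cancel₀ _ hM.ne']
  have e2 : ∀ i, |ε1 * w i / M| = u i := fun i => by
    rw [abs_div, abs_mul, abs_of_pos hε1, abs_of_pos hM]
  rw [e1] at hH
  simp only [e2] at hH
  refine hH.trans ?_
  unfold lpnorm
  have h5 : 0 ≤ ∑ i, u i ^ q := Finset.sum_nonneg fun i _ => Real.rpow_nonneg (hu0 i) _
  have h6 : 0 ≤ 1 / q := by positivity
  have h7 : 0 ≤ ∑ i, |x i| ^ p := Finset.sum_nonneg fun i _ => Real.rpow_nonneg (abs_nonneg _) _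
  gcongr

lemma aux_upper {d : ℕ} {ε1 εinf : ℝ} (hε1 : 0 < ε1) (hεinf : 0 < εinf)
    {p q : ℝ} (hpq : p.HolderConjugate q) (k : ℕ) (hk : k < d) (hk1 : 1 ≤ k) (α : ℝ)
    (hα0 : 0 ≤ α) (hα1 : α ≤ 1) (hs : εinf * (k + α) = ε1) (t : ℝ) (ht : 1 < t) :
    ∃ x : Fin d → ℝ, x ∉ convexHull ℝ ({y : Fin d → ℝ | l1norm y ≤ ε1} ∪
          {y : Fin d → ℝ | linfnorm y ≤ εinf}) ∧
      lpnorm p x = t * (ε1 / (k + α ^ q) ^ (1 / q)) := by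
  have hq1 : 1 < q := hpq.symm.lt
  have hp1 : 1 < p := hpq.lt
  have hαq : 0 ≤ α ^ q := Real.rpow_nonneg hα0 _
  have hk1' : (1:ℝ) ≤ k := by exact_mod_cast hk1
  set N : ℝ := k + α ^ q with hN
  have hNpos : 0 < N := by linarith
  let w : Fin d → ℝ := fun i => if (i : ℕ) < k then 1 else if (i : ℕ) = k then α else 0
  have hw0 : ∀ i, 0 ≤ w i := fun i => by
    simp only [w]; split_ifs <;> linarith
  have hw1 : ∀ i, w i ≤ 1 := fun i => by
    simp only [w]; split_ifs <;> linarith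
  have hwsum : ∑ i, w i = k + α := by
    simp only [w]; rw [aux_range 1 α k d hk]; ring
  have hwq : ∑ i, w i ^ q = N := by
    rw [hN, ← mul_one (k:ℝ), ← aux_range 1 (α ^ q) k d hk]
    refine Finset.sum_congr rfl fun i _ => ?_
    simp only [w]
    split_ifs
    · simp
    · rfl
    · exact Real.zero_rpow (by linarith)
  have hmul : ∀ i, w i ^ (q - 1) * w i = w i ^ q := fun i => by
    conv_lhs => rw [← Real.rpow_one (w i), ← Real.rpow_mul (hw0 i), one_mul]
    rw [← Real.rpow_add_of_nonneg (hw0 i) (by linarith) (by linarith)]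
    congr 1; ring
  have hc : 0 < t * ε1 / N := by positivity
  refine ⟨fun i => t * ε1 / N * w i ^ (q - 1), ?_, ?_⟩
  · intro hmem
    have hconv : Convex ℝ {y : Fin d → ℝ | ∑ i, w i * y i ≤ ε1} := by
      apply convex_halfSpace_le
      constructor
      · intro a b; simp [mul_add, Finset.sum_add_distrib]
      · intro c a; simp [Finset.mul_sum, mul_left_comm]
    have hsub := convexHull_min (s := {y : Fin d → ℝ | l1norm y ≤ ε1} ∪
          {y : Fin d → ℝ | linfnorm y ≤ εinf}) (t := {y : Fin d → ℝ | ∑ i, w i * y i ≤ ε1})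
          ?_ hconv hmem
    · have : ∑ i, w i * (t * ε1 / N * w i ^ (q - 1)) = t * ε1 := by
        have : ∀ i, w i * (t * ε1 / N * w i ^ (q - 1)) = t * ε1 / N * w i ^ q := fun i => by
          rw [← hmul]; ring
        simp only [this]
        rw [← Finset.mul_sum, hwq, div_mul_cancel₀ _ hNpos.ne']
      have h2 : ∑ i, w i * (t * ε1 / N * w i ^ (q - 1)) ≤ ε1 := hsub
      rw [this] at h2
      nlinarith
    · rintro y (hy | hy)
      · change ∑ i, |y i| ≤ ε1 at hy
        refine le_trans (Finset.sum_le_sum fun i _ => ?_) hy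
        have := le_abs_self (y i)
        have := abs_nonneg (y i)
        nlinarith [hw0 i, hw1 i]
      · show ∑ i, w i * y i ≤ ε1
        rw [← hs, ← hwsum, Finset.mul_sum]
        refine Finset.sum_le_sum fun i _ => ?_
        rw [mul_comm]
        exact mul_le_mul_of_nonneg_right ((le_abs_self _).trans (aux_linf y hy i)) (hw0 i)
  · unfold lpnorm
    have hqp : (q - 1) * p = q := by
      have := hpq.mul_eq_add
      linarith
    have : ∀ i, |t * ε1 / N * w i ^ (q - 1)| ^ p = (t * ε1 / N) ^ p * w i ^ q := fun i => by
      have h0 := Real.rpow_nonneg (hw0 i) (q - 1)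
      rw [abs_of_nonneg (by positivity), Real.mul_rpow hc.le h0, ← Real.rpow_mul (hw0 i), hqp]
    simp only [this]
    rw [← Finset.mul_sum, hwq, Real.mul_rpow (by positivity) hNpos.le, ← Real.rpow_mul hc.le,
      mul_one_div_cancel (by linarith), Real.rpow_one]
    have hsum : 1 / p + 1 / q = 1 := by
      have := hpq.inv_add_inv_eq_one
      simpa [one_div] using this
    have hNN : N ^ (1 / p) * N ^ (1 / q) = N := by
      rw [← Real.rpow_add hNpos, hsum, Real.rpow_one]
    have h8 : 0 < N ^ (1 / q) := Real.rpow_pos_of_pos hNpos _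
    have h9 : N ^ (1 / p) = N / N ^ (1 / q) := by
      rw [eq_div_iff h8.ne', hNN]
    rw [h9]
    field_simp

theorem min_lp_norm_complement_convex_hull
    (d : ℕ) (hd : 2 ≤ d) (ε1 εinf : ℝ) (hε1 : 0 < ε1) (hεinf : 0 < εinf)
    (h1 : εinf < ε1) (h2 : ε1 < d * εinf)
    (p q : ℝ) (hp : 1 < p) (hpq : 1 / p + 1 / q = 1)
    (α : ℝ) (hα : α = ε1 / εinf - ⌊ε1 / εinf⌋) :
    sInf {r : ℝ | ∃ x : Fin d → ℝ,
        x ∉ convexHull ℝ ({y : Fin d → ℝ | l1norm y ≤ ε1} ∪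
          {y : Fin d → ℝ | linfnorm y ≤ εinf}) ∧ r = lpnorm p x}
      = ε1 / (ε1 / εinf - α + α ^ q) ^ (1 / q) := by
  have hHC : p.HolderConjugate q := by
    rw [Real.holderConjugate_iff]
    exact ⟨hp, by simpa [one_div] using hpq⟩
  have hs1 : 1 < ε1 / εinf := by rwa [one_lt_div hεinf]
  have hsd : ε1 / εinf < d := by rwa [div_lt_iff₀ hεinf]
  have hαf : α = Int.fract (ε1 / εinf) := hα
  have hα0 : 0 ≤ α := hαf ▸ Int.fract_nonneg _
  have hα1 : α < 1 := hαf ▸ Int.fract_lt_one _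
  obtain ⟨k, hk⟩ := Int.eq_ofNat_of_zero_le (Int.floor_nonneg.2 (by linarith : 0 ≤ ε1 / εinf))
  have hkR : (⌊ε1 / εinf⌋ : ℝ) = k := by rw [hk]; simp
  have hks : ε1 / εinf - α = k := by rw [hα, hkR]; ring
  have hk1 : 1 ≤ k := by
    have : (0:ℝ) < k := by linarith
    exact_mod_cast this
  have hkd : k < d := by
    have : (k:ℝ) < d := by linarith
    exact_mod_cast this
  have hs : εinf * (k + α) = ε1 := by
    rw [← hks]; field_simp; ring
  rw [hks]
  have hNpos : 0 < (k + α ^ q : ℝ) := by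
    have := Real.rpow_nonneg hα0 q
    have : (1:ℝ) ≤ k := by exact_mod_cast hk1
    linarith
  have hDpos : 0 < (k + α ^ q : ℝ) ^ (1 / q) := Real.rpow_pos_of_pos hNpos _
  have hup := aux_upper hε1 hεinf hHC k hkd hk1 α hα0 hα1.le hs
  have hlow : ∀ r ∈ {r : ℝ | ∃ x : Fin d → ℝ,
        x ∉ convexHull ℝ ({y : Fin d → ℝ | l1norm y ≤ ε1} ∪
          {y : Fin d → ℝ | linfnorm y ≤ εinf}) ∧ r = lpnorm p x},
      ε1 / (k + α ^ q) ^ (1 / q) ≤ r := by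
    rintro r ⟨x, hx, rfl⟩
    have := aux_lower hd hε1 hεinf hHC x hx
    rw [hkR, ← hαf] at this
    rwa [div_le_iff₀ hDpos]
  apply le_antisymm
  · have hR : 0 < ε1 / (k + α ^ q) ^ (1 / q) := by positivity
    apply le_of_forall_gt_imp_ge_of_dense
    intro b hb
    obtain ⟨x, hx, hxn⟩ := hup (b / (ε1 / (k + α ^ q) ^ (1 / q))) (by rwa [one_lt_div hR])
    rw [div_mul_cancel₀ _ hR.ne'] at hxn
    exact csInf_le ⟨_, hlow⟩ ⟨x, hx, hxn.symm⟩
  · apply le_csInf _ hlow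
    obtain ⟨x, hx, hxn⟩ := hup 2 (by norm_num)
    exact ⟨_, x, hx, rfl⟩
end

section
/- Let d ≥ 2, let ε₁, ε_∞ > 0 with ε_∞ < ε₁ < d·ε_∞, let p ∈ (1, ∞) with Hölder conjugate q (1/p + 1/q = 1), and set α = ε₁/ε_∞ − ⌊ε₁/ε_∞⌋. Then every x : Fin d → ℝ with x ∉ C = convexHull ℝ (B₁ ∪ B_∞) satisfies ‖x‖_p ≥ ε₁ / (ε₁/ε_∞ − α + α^q)^(1/q). -/
open Finset

/-- Concentration bound function `⌊s⌋ + fract(s)^q`. -/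
noncomputable def auxF (q s : ℝ) : ℝ := (⌊s⌋ : ℝ) + (Int.fract s) ^ q

lemma auxF_mono {q s t : ℝ} (hq : 1 < q) (hst : s ≤ t) : auxF q s ≤ auxF q t := by
  unfold auxF
  have hs0 := Int.fract_nonneg s
  have hs1 := (Int.fract_lt_one s).le
  have ht0 := Int.fract_nonneg t
  rcases (Int.floor_mono hst).eq_or_lt with h | h
  · have : Int.fract s ≤ Int.fract t := by
      unfold Int.fract; rw [h]; linarith
    have := Real.rpow_le_rpow hs0 this (by linarith : 0 ≤ q)
    rw [h]; linarith
  · have h' : ((⌊s⌋ : ℤ) : ℝ) + 1 ≤ (⌊t⌋ : ℤ) := by exact_mod_cast h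
    have := Real.rpow_le_one hs0 hs1 (by linarith : 0 ≤ q)
    have := Real.rpow_nonneg ht0 q
    linarith

lemma aux_conv {q a u : ℝ} (hq : 1 < q) (ha1 : a < 1) (hu1 : u ≤ 1)
    (h : 1 ≤ a + u) : a ^ q + u ^ q ≤ 1 + (a + u - 1) ^ q := by
  have hc := convexOn_rpow hq.le
  have hD : 0 < 2 - a - u := by linarith
  have hm : (a + u - 1) ∈ Set.Ici (0:ℝ) := by simp only [Set.mem_Ici]; linarith
  have h1 : (1:ℝ) ∈ Set.Ici (0:ℝ) := by simp
  have hc2 : ∀ s t : ℝ, 0 ≤ s → 0 ≤ t → s + t = 1 →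
      (s • (1:ℝ) + t • (a + u - 1)) ^ q ≤ s • (1:ℝ) ^ q + t • (a + u - 1) ^ q :=
    fun s t hs ht hst => hc.2 h1 hm hs ht hst
  have e1 := hc2 ((1 - u) / (2 - a - u)) ((1 - a) / (2 - a - u))
    (div_nonneg (by linarith) hD.le) (div_nonneg (by linarith) hD.le) (by field_simp; ring)
  have e2 := hc2 ((1 - a) / (2 - a - u)) ((1 - u) / (2 - a - u))
    (div_nonneg (by linarith) hD.le) (div_nonneg (by linarith) hD.le) (by field_simp; ring)
  simp only [smul_eq_mul, Real.one_rpow] at e1 e2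
  have f1 : (1 - u) / (2 - a - u) * 1 + (1 - a) / (2 - a - u) * (a + u - 1) = a := by
    field_simp; ring
  have f2 : (1 - a) / (2 - a - u) * 1 + (1 - u) / (2 - a - u) * (a + u - 1) = u := by
    field_simp; ring
  rw [f1] at e1
  rw [f2] at e2
  have f3 : (1 - u) / (2 - a - u) + (1 - a) / (2 - a - u) = 1 := by
    field_simp; ring
  calc a ^ q + u ^ q ≤ ((1 - u) / (2 - a - u) + (1 - a) / (2 - a - u)) * (1 + (a + u - 1) ^ q) := by
        linarith
    _ = _ := by rw [f3, one_mul]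

lemma auxF_add {q s u : ℝ} (hq : 1 < q) (hu0 : 0 ≤ u) (hu1 : u ≤ 1) :
    auxF q s + u ^ q ≤ auxF q (s + u) := by
  have hs0 := Int.fract_nonneg s
  have hs1 := Int.fract_lt_one s
  have hs := Int.floor_add_fract s
  unfold auxF
  rcases lt_or_ge (Int.fract s + u) 1 with h | h
  · have hf : ⌊s + u⌋ = ⌊s⌋ := by
      rw [Int.floor_eq_iff]; constructor <;> linarith
    have hr : Int.fract (s + u) = Int.fract s + u := by
      have := Int.floor_add_fract (s + u); rw [hf] at this; linarith
    rw [hf, hr]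
    have := Real.add_rpow_le_rpow_add hs0 hu0 hq.le
    linarith
  · have hf : ⌊s + u⌋ = ⌊s⌋ + 1 := by
      rw [Int.floor_eq_iff]; push_cast; constructor <;> linarith
    have hr : Int.fract (s + u) = Int.fract s + u - 1 := by
      have := Int.floor_add_fract (s + u); rw [hf] at this; push_cast at this; linarith
    rw [hf, hr]
    have := aux_conv hq hs1 hu1 h
    push_cast; linarith

lemma sum_rpow_le_auxF {ι : Type*} (t : Finset ι) {q : ℝ} (hq : 1 < q) (u : ι → ℝ)
    (h0 : ∀ i, 0 ≤ u i) (h1 : ∀ i, u i ≤ 1) :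
    ∑ i ∈ t, u i ^ q ≤ auxF q (∑ i ∈ t, u i) := by
  classical
  induction t using Finset.induction_on with
  | empty => simp [auxF, Real.zero_rpow (by linarith : q ≠ 0)]
  | insert a t ha ih =>
    rw [sum_insert ha, sum_insert ha, add_comm, add_comm (u a)]
    have := auxF_add (s := ∑ i ∈ t, u i) hq (h0 a) (h1 a)
    linarith

lemma exists_dual {d : ℕ} (hd : 2 ≤ d) {ε1 εinf : ℝ} (hε1 : 0 < ε1) (hεinf : 0 < εinf)
    (x : Fin d → ℝ)
    (hx : x ∉ convexHull ℝ ({y : Fin d → ℝ | l1norm y ≤ ε1} ∪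
      {y : Fin d → ℝ | linfnorm y ≤ εinf})) :
    ∃ (w : Fin d → ℝ), 0 < ∑ i, w i * x i ∧ (∀ i, ε1 * |w i| ≤ ∑ i, w i * x i) ∧
      εinf * ∑ i, |w i| ≤ ∑ i, w i * x i := by
  classical
  have : Nonempty (Fin d) := ⟨⟨0, by omega⟩⟩
  let v1 : Fin d × Bool → (Fin d → ℝ) := fun ib => Pi.single ib.1 (if ib.2 then ε1 else -ε1)
  let v2 : (Fin d → Bool) → (Fin d → ℝ) := fun s i => if s i then εinf else -εinf
  have hfin : (Set.range v1 ∪ Set.range v2).Finite :=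
    (Set.finite_range v1).union (Set.finite_range v2)
  have hsub : (Set.range v1 ∪ Set.range v2) ⊆ ({y : Fin d → ℝ | l1norm y ≤ ε1} ∪
      {y : Fin d → ℝ | linfnorm y ≤ εinf}) := by
    apply Set.union_subset_union
    · rintro _ ⟨⟨i, b⟩, rfl⟩
      simp only [Set.mem_ofPred_eq, l1norm, v1]
      rw [Finset.sum_eq_single i]
      · cases b <;> simp [abs_of_pos hε1]
      · intro j _ hj; simp [Pi.single_eq_of_ne hj]
      · simp
    · rintro _ ⟨s, rfl⟩
      simp only [Set.mem_ofPred_eq, linfnorm, v2]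
      apply ciSup_le
      intro i
      split_ifs <;> simp [abs_of_pos hεinf]
  have hx' : x ∉ convexHull ℝ (Set.range v1 ∪ Set.range v2) :=
    fun h => hx (convexHull_mono hsub h)
  obtain ⟨f, c, hf, hc⟩ := geometric_hahn_banach_closed_point (convex_convexHull ℝ _)
    (hfin.isClosed_convexHull ℝ) hx'
  have hlin : ∀ y : Fin d → ℝ, f y = ∑ i, f (Pi.single i 1) * y i := by
    intro y
    have := LinearMap.pi_apply_eq_sum_univ (f : (Fin d → ℝ) →ₗ[ℝ] ℝ) y
    simp only [ContinuousLinearMap.coe_coe, smul_eq_mul] at this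
    rw [this]
    refine Finset.sum_congr rfl fun i _ => ?_
    rw [mul_comm]
    congr 2
    ext j
    simp [Pi.single_apply, eq_comm]
  have hV : ∀ y ∈ Set.range v1 ∪ Set.range v2, f y < f x := fun y hy =>
    (hf y (subset_convexHull ℝ _ hy)).trans hc
  have hA : ∀ i, ε1 * |f (Pi.single i 1)| < f x := by
    intro i
    have hb : ∀ b : Bool, (f (Pi.single i 1)) * (if b then ε1 else -ε1) < f x := by
      intro b
      have := hV (v1 (i, b)) (Or.inl ⟨_, rfl⟩)
      rw [hlin (v1 (i, b)), Finset.sum_eq_single i] at this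
      · simpa [v1] using this
      · intro j _ hj; simp [v1, Pi.single_eq_of_ne hj]
      · simp
    have ht := hb true
    have hfa := hb false
    simp only [if_true, Bool.false_eq_true, if_false] at ht hfa
    rcases abs_cases (f (Pi.single i 1)) with ⟨h, _⟩ | ⟨h, _⟩ <;> rw [h] <;> linarith
  have hB : εinf * ∑ i, |f (Pi.single i 1)| < f x := by
    have := hV (v2 (fun i => decide (0 ≤ f (Pi.single i 1)))) (Or.inr ⟨_, rfl⟩)
    rw [hlin (v2 _)] at this
    refine lt_of_eq_of_lt ?_ this
    rw [Finset.mul_sum]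
    refine Finset.sum_congr rfl fun i _ => ?_
    simp only [v2, decide_eq_true_eq]
    split_ifs with h
    · rw [abs_of_nonneg h]; ring
    · rw [abs_of_neg (not_le.1 h)]; ring
  have hpos : 0 < f x :=
    lt_of_le_of_lt (mul_nonneg hεinf.le (Finset.sum_nonneg fun i _ => abs_nonneg _)) hB
  refine ⟨fun i => f (Pi.single i 1), ?_, ?_, ?_⟩
  · rw [← hlin]; exact hpos
  · intro i; rw [← hlin]; exact (hA i).le
  · rw [← hlin]; exact hB.le



theorem lp_norm_lower_bound_outside_convex_hull
    (d : ℕ) (hd : 2 ≤ d) (ε1 εinf : ℝ) (hε1 : 0 < ε1) (hεinf : 0 < εinf)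
    (h1 : εinf < ε1) (h2 : ε1 < d * εinf)
    (p q : ℝ) (hp : 1 < p) (hpq : 1 / p + 1 / q = 1)
    (α : ℝ) (hα : α = ε1 / εinf - ⌊ε1 / εinf⌋)
    (x : Fin d → ℝ)
    (hx : x ∉ convexHull ℝ ({y : Fin d → ℝ | l1norm y ≤ ε1} ∪
      {y : Fin d → ℝ | linfnorm y ≤ εinf})) :
    lpnorm p x ≥ ε1 / (ε1 / εinf - α + α ^ q) ^ (1 / q) := by
  obtain ⟨w, hM, hw1, hw2⟩ := exists_dual hd hε1 hεinf x hx
  set M := ∑ i, w i * x i with hMdef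
  have hp0 : 0 < p := by linarith
  have hpq' : p.HolderConjugate q := by
    rw [Real.holderConjugate_iff]
    exact ⟨hp, by simpa [one_div] using hpq⟩
  have hq : 1 < q := hpq'.symm.lt
  have hq0 : 0 < q := by linarith
  let u : Fin d → ℝ := fun i => ε1 * |w i| / M
  have hu0 : ∀ i, 0 ≤ u i := fun i => by positivity
  have hu1 : ∀ i, u i ≤ 1 := fun i => (div_le_one hM).2 (hw1 i)
  have hus : ∑ i, u i ≤ ε1 / εinf := by
    have : ∑ i, u i = ε1 * (∑ i, |w i|) / M := by
      simp only [u]; rw [← Finset.sum_div, ← Finset.mul_sum]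
    rw [this, div_le_div_iff₀ hM hεinf]
    nlinarith
  have hS : ∑ i, u i ^ q ≤ ε1 / εinf - α + α ^ q := by
    refine (sum_rpow_le_auxF univ hq u hu0 hu1).trans ((auxF_mono hq hus).trans_eq ?_)
    unfold auxF
    rw [hα, Int.fract]; ring
  have hH := Real.inner_le_Lp_mul_Lq univ (fun i => |x i|) u hpq'
  have hE : ε1 ≤ ∑ i, |x i| * u i := by
    have e : ∑ i, |x i| * u i = ε1 / M * ∑ i, |w i * x i| := by
      rw [Finset.mul_sum]
      refine Finset.sum_congr rfl fun i _ => ?_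
      simp only [u, abs_mul]; ring
    have hle : M ≤ ∑ i, |w i * x i| := Finset.sum_le_sum fun i _ => le_abs_self _
    rw [e]
    calc ε1 = ε1 / M * M := by field_simp
      _ ≤ _ := mul_le_mul_of_nonneg_left hle (by positivity)
  simp only [abs_abs] at hH
  simp only [fun i => abs_of_nonneg (hu0 i)] at hH
  have hα0 : 0 ≤ α := by rw [hα]; exact Int.fract_nonneg _
  have hK : 0 < ε1 / εinf - α + α ^ q := by
    have h1' : (1:ℤ) ≤ ⌊ε1 / εinf⌋ := by
      rw [Int.le_floor]; push_cast; exact ((one_lt_div hεinf).2 h1).le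
    have h1'' : (1:ℝ) ≤ (⌊ε1 / εinf⌋ : ℤ) := by exact_mod_cast h1'
    have := Real.rpow_nonneg hα0 q
    linarith
  have hL : 0 ≤ lpnorm p x := by
    unfold lpnorm
    exact Real.rpow_nonneg (Finset.sum_nonneg fun i _ => Real.rpow_nonneg (abs_nonneg _) _) _
  rw [ge_iff_le, div_le_iff₀ (Real.rpow_pos_of_pos hK _)]
  refine hE.trans (hH.trans (mul_le_mul_of_nonneg_left ?_ hL))
  exact Real.rpow_le_rpow (Finset.sum_nonneg fun i _ => Real.rpow_nonneg (hu0 i) _) hS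
    (by positivity)
end

section
/- Let d ≥ 2, let ε₁, ε_∞ > 0 with ε_∞ < ε₁ < d·ε_∞, let p ∈ (1, ∞) with Hölder conjugate q (1/p + 1/q = 1), and set α = ε₁/ε_∞ − ⌊ε₁/ε_∞⌋. Then the closed l_p-ball {x : Fin d → ℝ | ‖x‖_p ≤ ε₁ / (ε₁/ε_∞ − α + α^q)^(1/q)} is contained in C = convexHull ℝ (B₁ ∪ B_∞). -/
open Finset

/-- The extremal profile: integer part plus the `q`-th power of the fractional part. -/
lemma profile_step (q : ℝ) (hq : 1 ≤ q) (a u : ℝ) (ha : 0 ≤ a) (ha1 : a < 1) (hu : 0 ≤ u)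
    (hu1 : u ≤ 1) (h : 1 ≤ a + u) : a ^ q + u ^ q ≤ 1 + (a + u - 1) ^ q := by
  have hc := convexOn_rpow hq
  -- with `b = a + u - 1`, both `a` and `u` lie in `[b, 1]`
  set b := a + u - 1 with hb
  have hb0 : 0 ≤ b := by linarith
  have hb1 : b < 1 := by linarith
  have key : ∀ s : ℝ, b ≤ s → s ≤ 1 →
      s ^ q ≤ ((1 - s) / (1 - b)) * b ^ q + ((s - b) / (1 - b)) * 1 := by
    intro s hs hs1
    have hpos : 0 < 1 - b := by linarith
    have n1 : 0 ≤ (1 - s) / (1 - b) := div_nonneg (by linarith) hpos.le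
    have n2 : 0 ≤ (s - b) / (1 - b) := div_nonneg (by linarith) hpos.le
    have n3 : (1 - s) / (1 - b) + (s - b) / (1 - b) = 1 := by field_simp; ring
    have hbm : b ∈ Set.Ici (0 : ℝ) := hb0
    have h1m : (1 : ℝ) ∈ Set.Ici (0 : ℝ) := by simp
    have := hc.2 hbm h1m n1 n2 n3
    simp only [smul_eq_mul, Real.one_rpow] at this
    have e : (1 - s) / (1 - b) * b + (s - b) / (1 - b) * 1 = s := by field_simp; ring
    rwa [e] at this
  have h1 := key a (by linarith) ha1.le
  have h2 := key u (by linarith) hu1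
  have hpos : 0 < 1 - b := by linarith
  have e1 : (1 - a) / (1 - b) + (1 - u) / (1 - b) = 1 := by
    rw [← add_div, div_eq_one_iff_eq hpos.ne']; linarith
  have e2 : (a - b) / (1 - b) + (u - b) / (1 - b) = 1 := by
    rw [← add_div, div_eq_one_iff_eq hpos.ne']; linarith
  calc a ^ q + u ^ q ≤ ((1 - a) / (1 - b) + (1 - u) / (1 - b)) * b ^ q
        + ((a - b) / (1 - b) + (u - b) / (1 - b)) := by linarith
    _ = 1 + b ^ q := by rw [e1, e2]; ring

lemma profile_add (q : ℝ) (hq : 1 ≤ q) (s u : ℝ) (hu : 0 ≤ u) (hu1 : u ≤ 1) :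
    (⌊s⌋ : ℝ) + Int.fract s ^ q + u ^ q ≤ (⌊s + u⌋ : ℝ) + Int.fract (s + u) ^ q := by
  have ha := Int.fract_nonneg s
  have ha1 := Int.fract_lt_one s
  have hs := Int.floor_add_fract s
  rcases lt_or_ge (Int.fract s + u) 1 with h | h
  · have hf : ⌊s + u⌋ = ⌊s⌋ := by
      rw [Int.floor_eq_iff]; constructor <;> linarith
    have hfr : Int.fract (s + u) = Int.fract s + u := by
      rw [Int.fract, hf]; linarith
    rw [hf, hfr]
    have := Real.add_rpow_le_rpow_add ha hu hq
    linarith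
  · have hf : ⌊s + u⌋ = ⌊s⌋ + 1 := by
      rw [Int.floor_eq_iff]; push_cast; constructor <;> linarith
    have hfr : Int.fract (s + u) = Int.fract s + u - 1 := by
      rw [Int.fract, hf]; push_cast; linarith
    rw [hf, hfr]
    have := profile_step q hq _ u ha ha1 hu hu1 h
    push_cast
    linarith

lemma profile_mono (q : ℝ) (hq : 1 ≤ q) (s t : ℝ) (h : s ≤ t) :
    (⌊s⌋ : ℝ) + Int.fract s ^ q ≤ (⌊t⌋ : ℝ) + Int.fract t ^ q := by
  have q0 : 0 ≤ q := by linarith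
  rcases (Int.floor_le_floor h).eq_or_lt with e | l
  · have : Int.fract s ≤ Int.fract t := by
      rw [Int.fract, Int.fract, e]; linarith
    rw [e]
    have := Real.rpow_le_rpow (Int.fract_nonneg s) this q0
    linarith
  · have l' : (⌊s⌋ : ℝ) + 1 ≤ ⌊t⌋ := by exact_mod_cast l
    have := Real.rpow_le_one (Int.fract_nonneg s) (Int.fract_lt_one s).le q0
    have := Real.rpow_nonneg (Int.fract_nonneg t) q
    linarith

lemma sum_rpow_le_profile {ι : Type*} (S : Finset ι) (q : ℝ) (hq : 1 ≤ q) (u : ι → ℝ)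
    (hu : ∀ i, 0 ≤ u i) (hu1 : ∀ i, u i ≤ 1) :
    ∑ i ∈ S, u i ^ q ≤ (⌊∑ i ∈ S, u i⌋ : ℝ) + Int.fract (∑ i ∈ S, u i) ^ q := by
  classical
  induction S using Finset.induction_on with
  | empty => simp [Real.zero_rpow (show q ≠ 0 by linarith)]
  | insert i S hi ih =>
    rw [Finset.sum_insert hi, Finset.sum_insert hi, add_comm (u i) (∑ i ∈ S, u i)]
    have := profile_add q hq (∑ i ∈ S, u i) (u i) (hu i) (hu1 i)
    linarith

lemma linfnorm_le {d : ℕ} (hd : 2 ≤ d) (y : Fin d → ℝ) (r : ℝ) :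
    linfnorm y ≤ r ↔ ∀ i, |y i| ≤ r := by
  have : Nonempty (Fin d) := ⟨⟨0, by omega⟩⟩
  constructor
  · intro h i
    exact (le_ciSup (f := fun i => |y i|) (Set.finite_range _).bddAbove i).trans h
  · intro h
    exact ciSup_le h

theorem lp_ball_subset_convex_hull
    (d : ℕ) (hd : 2 ≤ d) (ε1 εinf : ℝ) (hε1 : 0 < ε1) (hεinf : 0 < εinf)
    (h1 : εinf < ε1) (h2 : ε1 < d * εinf)
    (p q : ℝ) (hp : 1 < p) (hpq : 1 / p + 1 / q = 1)
    (α : ℝ) (hα : α = ε1 / εinf - ⌊ε1 / εinf⌋) :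
    {x : Fin d → ℝ | lpnorm p x ≤ ε1 / (ε1 / εinf - α + α ^ q) ^ (1 / q)} ⊆
      convexHull ℝ ({y : Fin d → ℝ | l1norm y ≤ ε1} ∪
        {y : Fin d → ℝ | linfnorm y ≤ εinf}) := by
  intro x hx
  simp only [Set.mem_ofPred_eq] at hx
  have hc : p.HolderConjugate q := Real.holderConjugate_iff.2 ⟨hp, by simpa using hpq⟩
  have hq : 1 < q := hc.symm.lt
  have q0 : 0 < q := by linarith
  by_contra hxC
  have hs : ∀ r : SignType, |(r : ℝ)| ≤ 1 := by
    intro r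
    cases r <;> simp
  -- separate `x` from the hull of finitely many points of the two balls
  set V1 : Set (Fin d → ℝ) := Set.range (fun z : Fin d × SignType =>
    (Pi.single z.1 (ε1 * (z.2 : ℝ)) : Fin d → ℝ)) with hV1
  set V2 : Set (Fin d → ℝ) := Set.range (fun (σ : Fin d → SignType) (i : Fin d) =>
    εinf * ((σ i : SignType) : ℝ)) with hV2
  have hV1s : V1 ⊆ {y : Fin d → ℝ | l1norm y ≤ ε1} := by
    rintro _ ⟨⟨i, s⟩, rfl⟩
    simp only [Set.mem_ofPred_eq, l1norm]
    rw [Finset.sum_eq_single i]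
    · rw [Pi.single_eq_same, abs_mul, abs_of_pos hε1]
      exact mul_le_of_le_one_right hε1.le (hs _)
    · intro j _ hj; simp [hj]
    · simp
  have hV2s : V2 ⊆ {y : Fin d → ℝ | linfnorm y ≤ εinf} := by
    rintro _ ⟨σ, rfl⟩
    simp only [Set.mem_ofPred_eq]
    rw [linfnorm_le hd]
    intro i
    rw [abs_mul, abs_of_pos hεinf]
    exact mul_le_of_le_one_right hεinf.le (hs _)
  have hcl : IsClosed (convexHull ℝ (V1 ∪ V2)) :=
    ((Set.finite_range _).union (Set.finite_range _)).isClosed_convexHull ℝ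
  have hxV : x ∉ convexHull ℝ (V1 ∪ V2) := fun h =>
    hxC (convexHull_mono (Set.union_subset_union hV1s hV2s) h)
  obtain ⟨f, u, hf, hfx⟩ := geometric_hahn_banach_closed_point (convex_convexHull ℝ _) hcl hxV
  have hf' := fun y hy => hf y (subset_convexHull ℝ _ hy)
  set w : Fin d → ℝ := fun i => f (Pi.single i 1) with hw
  have hfw : ∀ y, f y = ∑ i, w i * y i := by
    intro y
    have : y = ∑ i, y i • (Pi.single i (1 : ℝ) : Fin d → ℝ) := pi_eq_sum_univ' y
    conv_lhs => rw [this]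
    simp [hw, mul_comm]
  have u0 : 0 < u := by
    have := hf' 0 (Or.inr ⟨fun _ => 0, by ext; simp⟩)
    simpa using this
  have hwi : ∀ i, ε1 * |w i| ≤ u := by
    intro i
    have := hf' (Pi.single i (ε1 * (SignType.sign (w i) : ℝ)))
      (Or.inl ⟨(i, SignType.sign (w i)), rfl⟩)
    rw [hfw, Finset.sum_eq_single i (by intro j _ hj; simp [hj]) (by simp),
      Pi.single_eq_same] at this
    rw [← self_mul_sign]
    linarith
  have hws : εinf * ∑ i, |w i| ≤ u := by
    have := hf' (fun i => εinf * (SignType.sign (w i) : ℝ))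
      (Or.inr ⟨fun i => SignType.sign (w i), rfl⟩)
    rw [hfw] at this
    refine le_trans (le_of_eq ?_) this.le
    rw [Finset.mul_sum]
    refine Finset.sum_congr rfl fun i _ => ?_
    rw [← self_mul_sign]
    ring
  -- normalise
  set M := u / ε1 with hM
  have M0 : 0 < M := div_pos u0 hε1
  set t := ε1 / εinf with ht
  have hα' : α = Int.fract t := hα
  have hK : t - α + α ^ q = (⌊t⌋ : ℝ) + Int.fract t ^ q := by
    rw [hα', Int.self_sub_fract]
  have hK0 : 0 < t - α + α ^ q := by
    rw [hK]
    have : (1 : ℤ) ≤ ⌊t⌋ := by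
      rw [Int.le_floor, ht, le_div_iff₀ hεinf]; push_cast; linarith
    have : (1 : ℝ) ≤ ⌊t⌋ := by exact_mod_cast this
    have := Real.rpow_nonneg (Int.fract_nonneg t) q
    linarith
  have hsum : ∑ i, (|w i| / M) ^ q ≤ t - α + α ^ q := by
    rw [hK]
    refine (sum_rpow_le_profile _ q hq.le (fun i => |w i| / M)
      (fun i => by positivity) (fun i => ?_)).trans (profile_mono q hq.le _ _ ?_)
    · rw [div_le_one M0, hM, le_div_iff₀ hε1]; linarith [hwi i]
    · rw [← Finset.sum_div, div_le_iff₀ M0, ht, hM]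
      have : ε1 / εinf * (u / ε1) = u / εinf := by field_simp
      rw [this, le_div_iff₀ hεinf]; linarith
  have hwq : (∑ i, |w i| ^ q) ^ (1 / q) ≤ M * (t - α + α ^ q) ^ (1 / q) := by
    have e : ∑ i, |w i| ^ q = M ^ q * ∑ i, (|w i| / M) ^ q := by
      rw [Finset.mul_sum]
      refine Finset.sum_congr rfl fun i _ => ?_
      rw [← Real.mul_rpow M0.le (by positivity), mul_div_cancel₀ _ M0.ne']
    rw [e, Real.mul_rpow (by positivity) (Finset.sum_nonneg fun i _ => by positivity),
      ← Real.rpow_mul M0.le, mul_one_div_cancel q0.ne', Real.rpow_one]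
    gcongr
  have hH := Real.inner_le_Lp_mul_Lq Finset.univ w x hc.symm
  rw [← hfw] at hH
  have hKr : 0 < (t - α + α ^ q) ^ (1 / q) := Real.rpow_pos_of_pos hK0 _
  have : f x ≤ u := by
    refine hH.trans ?_
    calc _ ≤ (M * (t - α + α ^ q) ^ (1 / q)) * (ε1 / (t - α + α ^ q) ^ (1 / q)) := by
          refine mul_le_mul hwq hx ?_ (by positivity)
          exact Real.rpow_nonneg (Finset.sum_nonneg fun i _ => by positivity) _
      _ = u := by rw [hM]; field_simp
  linarith
end

section
/- Let d ≥ 2, let ε₁, ε_∞ > 0 with ε_∞ < ε₁ < d·ε_∞, and let p be a real number with p ≥ 1. Then the infimum of ‖x‖_p over all x : Fin d → ℝ lying outside the union B₁ ∪ B_∞ equals (ε_∞^p + (ε₁ − ε_∞)^p / (d−1)^(p−1))^(1/p). -/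
open Finset

theorem rpow_tangent_aux (t u p : ℝ) (ht : 0 < t) (hu : 0 ≤ u) (hp : 1 ≤ p) :
    t ^ p + p * t ^ (p - 1) * (u - t) ≤ u ^ p := by
  have hs : (-1 : ℝ) ≤ u / t - 1 := by
    have : 0 ≤ u / t := by positivity
    linarith
  have h := one_add_mul_self_le_rpow_one_add hs hp
  have e1 : 1 + (u / t - 1) = u / t := by ring
  rw [e1, Real.div_rpow hu ht.le] at h
  have htp : 0 < t ^ p := Real.rpow_pos_of_pos ht p
  rw [le_div_iff₀ htp] at h
  have e2 : t ^ (p - 1) = t ^ p / t := by rw [Real.rpow_sub ht, Real.rpow_one]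
  rw [e2]
  calc _ = (1 + p * (u / t - 1)) * t ^ p := by field_simp
    _ ≤ _ := h

theorem target_aux (n c p : ℝ) (hn : 0 < n) (hc : 0 ≤ c) :
    n * (c / n) ^ p = c ^ p / n ^ (p - 1) := by
  rw [Real.div_rpow hc hn.le, Real.rpow_sub hn, Real.rpow_one]
  have := Real.rpow_pos_of_pos hn p
  field_simp

theorem lower_aux (d : ℕ) (e t p s : ℝ) (ht : 0 < t) (hte : t ≤ e) (hp : 1 ≤ p)
    (x : Fin d → ℝ) (j : Fin d) (hj : e ≤ |x j|) (hs : s = e + ((d : ℝ) - 1) * t)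
    (hx : s ≤ ∑ i, |x i|) :
    e ^ p + ((d : ℝ) - 1) * t ^ p ≤ ∑ i, |x i| ^ p := by
  have he : 0 < e := by linarith
  have hcard : ((Finset.univ.erase j).card : ℝ) = (d : ℝ) - 1 := by
    rw [Finset.card_erase_of_mem (Finset.mem_univ j), Finset.card_univ, Fintype.card_fin,
      Nat.cast_sub (by have := j.2; omega)]
    simp
  rw [← Finset.add_sum_erase _ _ (Finset.mem_univ j)] at hx ⊢
  have ha := rpow_tangent_aux e |x j| p he (abs_nonneg _) hp
  have hb : ∑ i ∈ Finset.univ.erase j, (t ^ p + p * t ^ (p - 1) * (|x i| - t)) ≤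
      ∑ i ∈ Finset.univ.erase j, |x i| ^ p :=
    Finset.sum_le_sum fun i _ => rpow_tangent_aux t |x i| p ht (abs_nonneg _) hp
  rw [Finset.sum_add_distrib, ← Finset.mul_sum, Finset.sum_sub_distrib, Finset.sum_const,
    Finset.sum_const, nsmul_eq_mul, nsmul_eq_mul, hcard] at hb
  have hmono : t ^ (p - 1) ≤ e ^ (p - 1) := Real.rpow_le_rpow ht.le hte (by linarith)
  have h0 : 0 ≤ t ^ (p - 1) := Real.rpow_nonneg ht.le _
  have h3 : p * t ^ (p - 1) * (|x j| - e) ≤ p * e ^ (p - 1) * (|x j| - e) := by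
    have : 0 ≤ |x j| - e := by linarith
    gcongr
  have h4 : 0 ≤ p * t ^ (p - 1) *
      ((|x j| - e) + (∑ i ∈ Finset.univ.erase j, |x i| - ((d : ℝ) - 1) * t)) := by
    apply mul_nonneg (by positivity)
    linarith
  linarith

theorem min_lp_norm_complement_union
    (d : ℕ) (hd : 2 ≤ d) (ε1 εinf : ℝ) (hε1 : 0 < ε1) (hεinf : 0 < εinf)
    (h1 : εinf < ε1) (h2 : ε1 < d * εinf)
    (p : ℝ) (hp : 1 ≤ p) :
    sInf {r : ℝ | ∃ x : Fin d → ℝ,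
        x ∉ ({y : Fin d → ℝ | l1norm y ≤ ε1} ∪
          {y : Fin d → ℝ | linfnorm y ≤ εinf}) ∧ r = lpnorm p x}
      = (εinf ^ p + (ε1 - εinf) ^ p / ((d : ℝ) - 1) ^ (p - 1)) ^ (1 / p) := by
  have hd' : (2 : ℝ) ≤ d := by exact_mod_cast hd
  have hn : 0 < (d : ℝ) - 1 := by linarith
  rw [← target_aux _ _ p hn (by linarith)]
  set t := (ε1 - εinf) / ((d : ℝ) - 1) with htdef
  have ht : 0 < t := div_pos (by linarith) hn
  have hte : t ≤ εinf := by
    rw [htdef, div_le_iff₀ hn]; nlinarith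
  have hnt : ε1 = εinf + ((d : ℝ) - 1) * t := by
    rw [htdef]; field_simp; ring
  have hp0 : 0 < p := by linarith
  set j0 : Fin d := ⟨0, by omega⟩
  have hcard : ((Finset.univ.erase j0).card : ℝ) = (d : ℝ) - 1 := by
    rw [Finset.card_erase_of_mem (Finset.mem_univ j0), Finset.card_univ, Fintype.card_fin,
      Nat.cast_sub (by omega)]
    simp
  have hlow : ∀ r ∈ {r : ℝ | ∃ x : Fin d → ℝ,
        x ∉ ({y : Fin d → ℝ | l1norm y ≤ ε1} ∪
          {y : Fin d → ℝ | linfnorm y ≤ εinf}) ∧ r = lpnorm p x},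
      (εinf ^ p + ((d : ℝ) - 1) * t ^ p) ^ (1 / p) ≤ r := by
    rintro r ⟨x, hx, rfl⟩
    simp only [Set.mem_union, Set.mem_setOf_eq, not_or, not_le, l1norm, linfnorm] at hx
    obtain ⟨hx1, hx2⟩ := hx
    haveI : Nonempty (Fin d) := ⟨j0⟩
    obtain ⟨j, hj⟩ := exists_lt_of_lt_ciSup hx2
    unfold lpnorm
    apply Real.rpow_le_rpow
    · have := Real.rpow_nonneg hεinf.le p
      have := Real.rpow_nonneg ht.le p
      positivity
    · exact lower_aux d εinf t p ε1 ht hte hp x j hj.le hnt hx1.le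
    · positivity
  have hmem : ∀ δ : ℝ, 0 < δ →
      ((εinf + δ) ^ p + ((d : ℝ) - 1) * (t + δ) ^ p) ^ (1 / p) ∈ {r : ℝ | ∃ x : Fin d → ℝ,
        x ∉ ({y : Fin d → ℝ | l1norm y ≤ ε1} ∪
          {y : Fin d → ℝ | linfnorm y ≤ εinf}) ∧ r = lpnorm p x} := by
    intro δ hδ
    have key : ∀ f : ℝ → ℝ, ∑ i : Fin d, f (if i = j0 then εinf + δ else t + δ) =
        f (εinf + δ) + ((d : ℝ) - 1) * f (t + δ) := by
      intro f
      rw [← Finset.add_sum_erase _ _ (Finset.mem_univ j0), if_pos rfl,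
        Finset.sum_congr rfl (g := fun _ => f (t + δ)), Finset.sum_const, nsmul_eq_mul, hcard]
      intro i hi
      rw [if_neg (Finset.ne_of_mem_erase hi)]
    have ha1 : |εinf + δ| = εinf + δ := abs_of_pos (by linarith)
    have ha2 : |t + δ| = t + δ := abs_of_pos (by linarith)
    refine ⟨fun i => if i = j0 then εinf + δ else t + δ, ?_, ?_⟩
    · simp only [Set.mem_union, Set.mem_setOf_eq, not_or, not_le]
      constructor
      · unfold l1norm
        rw [key (fun y => |y|), ha1, ha2]
        nlinarith
      · unfold linfnorm
        refine lt_of_lt_of_le ?_ (le_ciSup (Set.finite_range _).bddAbove j0)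
        simp only [if_true]
        rw [ha1]; linarith
    · unfold lpnorm
      rw [key (fun y => |y| ^ p), ha1, ha2]
  apply le_antisymm
  · have hc : Continuous fun δ : ℝ =>
        ((εinf + δ) ^ p + ((d : ℝ) - 1) * (t + δ) ^ p) ^ (1 / p) := by
      have hp' : 0 ≤ 1 / p := by positivity
      refine Continuous.rpow_const ?_ fun _ => Or.inr hp'
      refine Continuous.add ?_ (Continuous.mul continuous_const ?_)
      · exact Continuous.rpow_const (by fun_prop) fun _ => Or.inr hp0.le
      · exact Continuous.rpow_const (by fun_prop) fun _ => Or.inr hp0.le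
    have hl := (hc.tendsto 0).mono_left (nhdsWithin_le_nhds (s := Set.Ioi 0))
    simp only [add_zero] at hl
    refine ge_of_tendsto hl ?_
    filter_upwards [self_mem_nhdsWithin] with δ hδ
    exact csInf_le ⟨_, hlow⟩ (hmem δ hδ)
  · exact le_csInf ⟨_, hmem 1 one_pos⟩ hlow
end

section
/- Let d ≥ 2 and let p be a real number with p ≥ 1. Then every x : Fin d → ℝ satisfies ∑ i, |x i|^p ≥ ‖x‖_∞^p + (‖x‖₁ − ‖x‖_∞)^p / (d−1)^(p−1). -/
open Finset

theorem sum_abs_rpow_lower_bound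
    (d : ℕ) (hd : 2 ≤ d) (p : ℝ) (hp : 1 ≤ p) (x : Fin d → ℝ) :
    ∑ i, |x i| ^ p ≥
      linfnorm x ^ p + (l1norm x - linfnorm x) ^ p / ((d : ℝ) - 1) ^ (p - 1) := by
  have : Nonempty (Fin d) := ⟨⟨0, by omega⟩⟩
  obtain ⟨j, hj⟩ := exists_eq_ciSup_of_finite (f := fun i => |x i|)
  have hinf : linfnorm x = |x j| := hj.symm
  have h1 : l1norm x = |x j| + ∑ i ∈ univ.erase j, |x i| :=
    (Finset.add_sum_erase univ (fun i => |x i|) (mem_univ j)).symm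
  have h2 : ∑ i, |x i| ^ p = |x j| ^ p + ∑ i ∈ univ.erase j, |x i| ^ p :=
    (Finset.add_sum_erase univ (fun i => |x i| ^ p) (mem_univ j)).symm
  have h3 := Real.rpow_sum_le_const_mul_sum_rpow (univ.erase j) x hp
  have hc : ((#(univ.erase j) : ℕ) : ℝ) = (d : ℝ) - 1 := by
    rw [Finset.card_erase_of_mem (mem_univ j), Finset.card_univ, Fintype.card_fin,
      Nat.cast_sub (by omega), Nat.cast_one]
  rw [hc] at h3
  have hd' : (2 : ℝ) ≤ d := by exact_mod_cast hd
  have hpos : 0 < ((d : ℝ) - 1) ^ (p - 1) := Real.rpow_pos_of_pos (by linarith) _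
  rw [hinf, h1, h2, add_sub_cancel_left]
  have h4 := (div_le_iff₀' hpos).2 h3
  linarith
end

section
/- Let d ≥ 2, let A, B > 0 with B ≤ A ≤ d·B, let q ∈ (1, ∞), and set k = ⌊A/B⌋ (a natural number). Then every v : Fin d → ℝ with ‖v‖_∞ ≤ B and ‖v‖₁ ≤ A satisfies ∑ i, |v i|^q ≤ k·B^q + (A − k·B)^q. -/
open Finset

theorem aux_conv_s8 (q : ℝ) (hq : 1 < q) (r x B : ℝ) (hr : 0 ≤ r) (hrx : r ≤ x) (hxB : x ≤ B) :
    x ^ q + (r + B - x) ^ q ≤ B ^ q + r ^ q := by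
  rcases eq_or_lt_of_le (hrx.trans hxB) with h | h
  · have hx : x = B := by linarith
    subst hx
    subst h
    simp
  · have hc := convexOn_rpow hq.le
    have hpos : 0 < B - r := by linarith
    have ht : 0 ≤ (B - x) / (B - r) := div_nonneg (by linarith) hpos.le
    have hu : 0 ≤ (x - r) / (B - r) := div_nonneg (by linarith) hpos.le
    have htu : (B - x) / (B - r) + (x - r) / (B - r) = 1 := by field_simp; ring
    have hrm : r ∈ Set.Ici (0 : ℝ) := hr
    have hBm : B ∈ Set.Ici (0 : ℝ) := by simp only [Set.mem_Ici]; linarith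
    have e1 := hc.2 hrm hBm ht hu htu
    have e2 := hc.2 hBm hrm ht hu htu
    simp only [smul_eq_mul] at e1 e2
    have i1 : (B - x) / (B - r) * r + (x - r) / (B - r) * B = x := by field_simp; ring
    have i2 : (B - x) / (B - r) * B + (x - r) / (B - r) * r = r + B - x := by field_simp; ring
    rw [i1] at e1
    rw [i2] at e2
    have : (x - r) / (B - r) = 1 - (B - x) / (B - r) := by linarith
    rw [this] at e1 e2
    linarith

theorem aux_sum_s8 {ι : Type*} (q : ℝ) (hq : 1 < q) (B : ℝ) (hB : 0 < B) (f : ι → ℝ)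
    (hf0 : ∀ i, 0 ≤ f i) (hfB : ∀ i, f i ≤ B) (s : Finset ι) :
    ∀ (k : ℕ) (r : ℝ), 0 ≤ r → r ≤ B → ∑ i ∈ s, f i ≤ k * B + r →
      ∑ i ∈ s, f i ^ q ≤ k * B ^ q + r ^ q := by
  classical
  induction s using Finset.induction_on with
  | empty =>
    intro k r hr _ _
    simp only [Finset.sum_empty]
    positivity
  | insert a s ha ih =>
    intro k r hr hrB hs
    rw [Finset.sum_insert ha] at hs ⊢
    have hsn : 0 ≤ ∑ i ∈ s, f i := Finset.sum_nonneg fun i _ => hf0 i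
    rcases le_total (f a) r with h | h
    · have e := ih k (r - f a) (by linarith) (by linarith [hf0 a]) (by linarith)
      have c := aux_conv_s8 q hq 0 (f a) r le_rfl (hf0 a) h
      rw [Real.zero_rpow (by linarith), zero_add] at c
      linarith
    · have c := aux_conv_s8 q hq r (f a) B hr h (hfB a)
      cases k with
      | zero =>
        have hx : f a = r := by
          simp only [Nat.cast_zero, zero_mul, zero_add] at hs
          linarith
        have e := ih 0 0 le_rfl hB.le (by
          simp only [Nat.cast_zero, zero_mul, zero_add] at hs ⊢
          linarith)
        rw [Real.zero_rpow (by linarith)] at e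
        rw [hx]
        linarith
      | succ k =>
        push_cast at hs ⊢
        have e := ih k (r + B - f a) (by linarith [hfB a]) (by linarith) (by linarith)
        linarith

theorem dual_sum_rpow_upper_bound
    (d : ℕ) (hd : 2 ≤ d) (A B : ℝ) (hA : 0 < A) (hB : 0 < B)
    (h1 : B ≤ A) (h2 : A ≤ d * B)
    (q : ℝ) (hq : 1 < q)
    (k : ℕ) (hk : k = ⌊A / B⌋₊)
    (v : Fin d → ℝ) (hvinf : linfnorm v ≤ B) (hv1 : l1norm v ≤ A) :
    ∑ i, |v i| ^ q ≤ k * B ^ q + (A - k * B) ^ q := by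
  have hfB : ∀ i, |v i| ≤ B := fun i =>
    (le_ciSup (f := fun i => |v i|) (Set.finite_range _).bddAbove i).trans hvinf
  have hk1 : (k : ℝ) ≤ A / B := by
    rw [hk]; exact Nat.floor_le (by positivity)
  have hk2 : A / B < k + 1 := by
    rw [hk]; exact Nat.lt_floor_add_one _
  rw [le_div_iff₀ hB] at hk1
  rw [div_lt_iff₀ hB] at hk2
  unfold l1norm at hv1
  exact aux_sum_s8 q hq B hB (fun i => |v i|) (fun i => abs_nonneg _) hfB Finset.univ k (A - k * B)
    (by linarith) (by linarith) (by simpa using hv1)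
end

section
/- Let d ≥ 1 and K ≥ 2, let V : Fin K → (Fin d → ℝ) and a : Fin K → ℝ, and define the affine classifier f r z = (∑ i, V r i * z i) + a r for r : Fin K. Let p ∈ (1, ∞) with Hölder conjugate q (1/p + 1/q = 1), let x : Fin d → ℝ, let c : Fin K, and let R ≥ 0. If for every s ≠ c one has f c x − f s x ≥ R · ‖V c − V s‖_q, then for every δ : Fin d → ℝ with ‖δ‖_p ≤ R and every s : Fin K, f c (x + δ) ≥ f s (x + δ); i.e., the decision of the affine classifier cannot change within the closed l_p-ball of radius R around x. -/
open Finset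

theorem affine_classifier_lp_robustness
    (d K : ℕ) (hd : 1 ≤ d) (hK : 2 ≤ K)
    (V : Fin K → Fin d → ℝ) (a : Fin K → ℝ)
    (f : Fin K → (Fin d → ℝ) → ℝ)
    (hf : ∀ r z, f r z = (∑ i, V r i * z i) + a r)
    (p q : ℝ) (hp : 1 < p) (hpq : 1 / p + 1 / q = 1)
    (x : Fin d → ℝ) (c : Fin K) (R : ℝ) (hR : 0 ≤ R)
    (h : ∀ s : Fin K, s ≠ c → f c x - f s x ≥ R * lpnorm q (V c - V s)) :
    ∀ δ : Fin d → ℝ, lpnorm p δ ≤ R → ∀ s : Fin K, f c (x + δ) ≥ f s (x + δ) := by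
  intro δ hδ s
  by_cases hs : s = c
  · rw [hs]
  have hH : p.HolderConjugate q := by
    rw [Real.holderConjugate_iff]
    exact ⟨hp, by simpa [one_div] using hpq⟩
  have h1 := Real.inner_le_Lp_mul_Lq Finset.univ δ (fun i => -((V c - V s) i)) hH
  simp only [abs_neg] at h1
  have h2 : 0 ≤ lpnorm q (V c - V s) := by
    unfold lpnorm
    positivity
  have h3 : ∑ i, δ i * -((V c - V s) i) ≤ R * lpnorm q (V c - V s) :=
    h1.trans (mul_le_mul_of_nonneg_right hδ h2)
  have h4 := h s hs
  have h5 : ∑ i, δ i * -((V c - V s) i) = ∑ i, V s i * δ i - ∑ i, V c i * δ i := by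
    rw [← Finset.sum_sub_distrib]
    refine Finset.sum_congr rfl fun i _ => ?_
    simp only [Pi.sub_apply]
    ring
  have h6 : ∀ r, f r (x + δ) = f r x + ∑ i, V r i * δ i := by
    intro r
    rw [hf, hf]
    simp only [Pi.add_apply, mul_add, Finset.sum_add_distrib]
    ring
  rw [h6, h6]
  linarith
end

section
/- Let m ≥ 1 and let A be an invertible m × m real matrix all of whose entries are 1 or −1. If v : Fin m → ℝ satisfies, for every i, ∑ j, A j i * v j = ‖v‖₁ (i.e., Aᵀ v is the constant vector with all entries equal to ‖v‖₁), then at most one coordinate of v is nonzero. -/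
open Finset

theorem pm_one_matrix_equality_case
    (m : ℕ) (hm : 1 ≤ m)
    (A : Matrix (Fin m) (Fin m) ℝ) (hA : IsUnit A)
    (hentries : ∀ i j, A i j = 1 ∨ A i j = -1)
    (v : Fin m → ℝ)
    (hv : ∀ i : Fin m, ∑ j, A j i * v j = ∑ j, |v j|) :
    ∀ i j : Fin m, v i ≠ 0 → v j ≠ 0 → i = j := by
  have key : ∀ k i, A k i * v k = |v k| := by
    intro k i
    have hle : ∀ j ∈ (Finset.univ : Finset (Fin m)), A j i * v j ≤ |v j| := by
      intro j _
      rcases hentries j i with h | h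
      · rw [h, one_mul]; exact le_abs_self _
      · rw [h, neg_one_mul]; exact neg_le_abs _
    exact (Finset.sum_eq_sum_iff_of_le hle).1 (hv i) k (Finset.mem_univ k)
  intro a b ha hb
  by_contra hab
  have hinj := Matrix.vecMul_injective_of_isUnit hA
  have h0 : (Pi.single a (v a * |v b|) - Pi.single b (v b * |v a|) : Fin m → ℝ) = 0 := by
    apply hinj
    ext i
    simp only [Matrix.sub_vecMul, Matrix.single_vecMul, Matrix.zero_vecMul, Pi.sub_apply,
      Pi.smul_apply, Matrix.row_apply, smul_eq_mul, Pi.zero_apply]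
    linear_combination |v b| * key a i - |v a| * key b i
  have h1 := congrFun h0 a
  simp [hab, ha, hb] at h1
end

section
/- Let d ≥ 2, let ε₁, ε_∞ > 0 with ε_∞ < ε₁ < d·ε_∞, and let p ∈ (1, ∞) with Hölder conjugate q (1/p + 1/q = 1). Then every x : Fin d → ℝ with x ∉ C = convexHull ℝ (B₁ ∪ B_∞) satisfies ‖x‖_p ≥ ε₁^(1/p) · ε_∞^(1/q); in particular, for p = 2 every point outside C has l₂-norm at least √(ε₁ · ε_∞). -/
open Finset

theorem lp_norm_outside_hull_geometric_mean_bound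
    (d : ℕ) (hd : 2 ≤ d) (ε1 εinf : ℝ) (hε1 : 0 < ε1) (hεinf : 0 < εinf)
    (h1 : εinf < ε1) (h2 : ε1 < d * εinf)
    (p q : ℝ) (hp : 1 < p) (hpq : 1 / p + 1 / q = 1)
    (x : Fin d → ℝ)
    (hx : x ∉ convexHull ℝ ({y : Fin d → ℝ | l1norm y ≤ ε1} ∪
      {y : Fin d → ℝ | linfnorm y ≤ εinf})) :
    lpnorm p x ≥ ε1 ^ (1 / p) * εinf ^ (1 / q) := by
  have hne : Nonempty (Fin d) := ⟨⟨0, by omega⟩⟩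
  have hc : p.HolderConjugate q := by
    rw [Real.holderConjugate_iff]
    exact ⟨hp, by simpa [one_div] using hpq⟩
  set U1 : Set (Fin d → ℝ) := {y | ∑ i, |y i| < ε1} with hU1
  set U2 : Set (Fin d → ℝ) := {y | ∀ i, |y i| < εinf} with hU2
  have o1 : IsOpen U1 := isOpen_lt (by fun_prop) (by fun_prop)
  have o2 : IsOpen U2 := by
    rw [hU2, Set.ofPred_forall]
    exact isOpen_iInter_of_finite fun i => isOpen_lt (by fun_prop) (by fun_prop)
  have hxU : x ∉ convexHull ℝ (U1 ∪ U2) := by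
    refine fun h => hx (convexHull_mono (Set.union_subset_union ?_ ?_) h)
    · intro y hy
      exact le_of_lt (show ∑ i, |y i| < ε1 from hy)
    · intro y hy
      exact ciSup_le fun i => (hy i).le
  obtain ⟨f, hf⟩ := geometric_hahn_banach_open_point (convex_convexHull ℝ (U1 ∪ U2))
    (o1.union o2).convexHull hxU
  have hF : 0 < f x := by
    have := hf 0 (subset_convexHull ℝ _ (Or.inl (by simpa [hU1] using hε1)))
    simpa using this
  have hU : ∀ y, (∀ r : ℝ, 0 < r → r < 1 → r • y ∈ U1 ∪ U2) → f y ≤ f x := by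
    intro y hy
    by_contra hlt
    push Not at hlt
    have hy0 : 0 < f y := hF.trans hlt
    have := hf _ (subset_convexHull ℝ _ (hy (f x / f y) (by positivity)
      ((div_lt_one hy0).2 hlt)))
    rw [map_smul, smul_eq_mul, div_mul_cancel₀ _ hy0.ne'] at this
    exact lt_irrefl _ this
  set w : Fin d → ℝ := fun i => f (Pi.single i 1) with hw
  have hfw : ∀ y, f y = ∑ i, y i * w i := by
    intro y
    have e : y = ∑ i, y i • (Pi.single i (1 : ℝ) : Fin d → ℝ) := by
      ext j
      simp [Finset.sum_apply, Pi.single_apply]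
    conv_lhs => rw [e]
    simp only [map_sum, map_smul, smul_eq_mul, hw]
  have hsg : ∀ a : ℝ, |(SignType.sign a : ℝ)| ≤ 1 := by
    intro a
    rcases lt_trichotomy a 0 with h | h | h <;> simp [h]
  have m1 : ∀ i, ε1 * |w i| ≤ f x := by
    intro i
    have := hU (Pi.single i (ε1 * SignType.sign (w i))) (by
      intro r hr0 hr1
      left
      simp only [hU1, Set.mem_ofPred_eq]
      rw [Finset.sum_eq_single i]
      · simp only [Pi.smul_apply, Pi.single_eq_same, smul_eq_mul, abs_mul, abs_of_pos hr0,
          abs_of_pos hε1]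
        have := hsg (w i)
        have h3 : ε1 * |(SignType.sign (w i) : ℝ)| ≤ ε1 := by nlinarith
        nlinarith
      · intro j _ hj
        simp [hj]
      · simp)
    rw [hfw, Finset.sum_eq_single i] at this
    · rw [Pi.single_eq_same, mul_assoc, sign_mul_self] at this
      exact this
    · intro j _ hj
      simp [hj]
    · simp
  have m2 : εinf * ∑ i, |w i| ≤ f x := by
    have := hU (fun i => εinf * SignType.sign (w i)) (by
      intro r hr0 hr1
      right
      intro i
      simp only [Pi.smul_apply, smul_eq_mul, abs_mul, abs_of_pos hr0, abs_of_pos hεinf]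
      have := hsg (w i)
      have h3 : εinf * |(SignType.sign (w i) : ℝ)| ≤ εinf := by nlinarith
      nlinarith)
    rw [hfw] at this
    simpa only [mul_assoc, sign_mul_self, ← Finset.mul_sum] using this
  have hp0 := hc.pos
  have hq0 := hc.symm.pos
  have hq1 := hc.symm.lt
  have holder : f x ≤ lpnorm p x * (∑ i, |w i| ^ q) ^ (1 / q) := by
    rw [hfw]
    exact Real.inner_le_Lp_mul_Lq _ _ _ hc
  generalize f x = F at *
  have hs : ∑ i, |w i| ^ q ≤ (F / ε1) ^ (q - 1) * (F / εinf) := by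
    calc ∑ i, |w i| ^ q ≤ ∑ i, (F / ε1) ^ (q - 1) * |w i| := by
          refine Finset.sum_le_sum fun i _ => ?_
          have e : |w i| ^ q = |w i| ^ (q - 1) * |w i| := by
            conv_lhs => rw [show q = (q - 1) + 1 by ring]
            rw [Real.rpow_add_one' (abs_nonneg _) (by linarith)]
          rw [e]
          refine mul_le_mul_of_nonneg_right (Real.rpow_le_rpow (abs_nonneg _) ?_ (by linarith))
            (abs_nonneg _)
          rw [le_div_iff₀ hε1, mul_comm]
          exact m1 i
      _ = (F / ε1) ^ (q - 1) * ∑ i, |w i| := by rw [Finset.mul_sum]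
      _ ≤ _ := by
          refine mul_le_mul_of_nonneg_left ?_ (by positivity)
          rw [le_div_iff₀ hεinf, mul_comm]
          exact m2
  have hs2 : (∑ i, |w i| ^ q) ^ (1 / q) ≤ F / (ε1 ^ (1 / p) * εinf ^ (1 / q)) := by
    refine (Real.rpow_le_rpow (Finset.sum_nonneg fun i _ => by positivity) hs
      (by positivity)).trans (le_of_eq ?_)
    have e : (q - 1) * (1 / q) = 1 / p := by
      rw [eq_sub_of_add_eq hpq]
      field_simp
    rw [Real.mul_rpow (by positivity) (by positivity), ← Real.rpow_mul (by positivity), e,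
      Real.div_rpow hF.le hε1.le, Real.div_rpow hF.le hεinf.le, div_mul_div_comm,
      ← Real.rpow_add hF, hpq, Real.rpow_one]
  have hl : 0 ≤ lpnorm p x := by
    unfold lpnorm
    positivity
  have hA : 0 < ε1 ^ (1 / p) * εinf ^ (1 / q) := by positivity
  have := holder.trans (mul_le_mul_of_nonneg_left hs2 hl)
  rw [mul_div_assoc', le_div_iff₀ hA, mul_comm (lpnorm p x)] at this
  exact le_of_mul_le_mul_left this hF
end

section
/- Let d ≥ 2, let ε₁, ε_∞ > 0 with ε_∞ < ε₁ < d·ε_∞, let p ∈ (1, ∞) with Hölder conjugate q (1/p + 1/q = 1), and set α = ε₁/ε_∞ − ⌊ε₁/ε_∞⌋. Then ε₁ / (ε₁/ε_∞ − α + α^q)^(1/q) ≥ (ε_∞^p + (ε₁ − ε_∞)^p / (d−1)^(p−1))^(1/p); i.e., the exact minimal l_p-norm over the complement of the convex hull of B₁ ∪ B_∞ is at least the exact minimal l_p-norm over the complement of the union B₁ ∪ B_∞. -/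
theorem aux_core (n m α p q : ℝ) (hn : 1 ≤ n) (hnm : n ≤ m) (hα0 : 0 ≤ α) (hα1 : α < 1)
    (ht1 : 1 < n + α) (htm : n + α < m + 1) (hp : 1 < p) (hq : 1 < q) (hpq' : (q - 1) * p = q) :
    1 + (n + α - 1) ^ p / m ^ (p - 1) ≤ ((n + α) / (n + α ^ q)) ^ p * (n + α ^ q) := by
  have hm : 0 < m := by linarith
  have hn0 : 0 < n := by linarith
  have hαq0 : 0 ≤ α ^ q := Real.rpow_nonneg hα0 _
  have hβ0 : 0 ≤ α ^ (q - 1) := Real.rpow_nonneg hα0 _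
  have hαq : α ^ q ≤ α := by
    simpa using Real.rpow_le_rpow_of_exponent_ge' hα0 hα1.le zero_le_one hq.le
  have hαβ : α ^ q ≤ α ^ (q - 1) :=
    Real.rpow_le_rpow_of_exponent_ge' hα0 hα1.le (by linarith) (by linarith)
  have hβp : (α ^ (q - 1)) ^ p = α ^ q := by rw [← Real.rpow_mul hα0, hpq']
  set A := α ^ q with hA
  set β := α ^ (q - 1) with hβ
  set t := n + α with ht
  set D := n + A with hD
  have hD0 : 0 < D := by linarith
  set c := t / D with hc
  have hcD : c * D = t := by rw [hc]; field_simp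
  have hc1 : 1 ≤ c := by rw [hc, le_div_iff₀ hD0]; linarith
  have hct : c ≤ t := by rw [hc, div_le_iff₀ hD0]; nlinarith
  have key : ∀ x k : ℝ, 0 ≤ x → 0 < k → x ^ p / k ^ (p - 1) = k * (x / k) ^ p := by
    intro x k hx hk
    rw [Real.div_rpow hx hk.le, Real.rpow_sub_one hk.ne']
    field_simp
  -- monotonicity in c
  have step1 : 1 + (t - 1) ^ p / m ^ (p - 1) ≤ c ^ p + (t - c) ^ p / m ^ (p - 1) := by
    rw [key _ _ (by linarith) hm, key _ _ (by linarith) hm]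
    set a := (t - 1) / m with ha
    set b := (t - c) / m with hb
    have ha0 : 0 < a := div_pos (by linarith) hm
    have hb0 : 0 ≤ b := div_nonneg (by linarith) hm.le
    have ha1 : a ≤ 1 := by rw [ha, div_le_one hm]; linarith
    have hma : m * a = t - 1 := by rw [ha]; field_simp
    have hmb : m * b = t - c := by rw [hb]; field_simp
    have hba : b ≤ a := by
      by_contra h
      push Not at h
      nlinarith
    have b1 := one_add_mul_self_le_rpow_one_add (s := c - 1) (by linarith) hp.le
    have b2 := one_add_mul_self_le_rpow_one_add (s := b / a - 1)
      (by have := div_nonneg hb0 ha0.le; linarith) hp.le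
    rw [add_sub_cancel] at b1 b2
    rw [Real.div_rpow hb0 ha0.le, le_div_iff₀ (by positivity)] at b2
    have e : a ^ p = a ^ (p - 1) * a := by rw [Real.rpow_sub_one ha0.ne']; field_simp
    have hle : a ^ (p - 1) ≤ 1 := Real.rpow_le_one ha0.le ha1 (by linarith)
    have e2 : (1 + p * (b / a - 1)) * a ^ p = a ^ p - p * (a - b) * a ^ (p - 1) := by
      rw [e]; field_simp; ring
    rw [e2] at b2
    have h3 : p * (a - b) * a ^ (p - 1) ≤ p * (a - b) * 1 :=
      mul_le_mul_of_nonneg_left hle (mul_nonneg (by linarith) (by linarith))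
    have h4 : m * (a ^ p - b ^ p) ≤ m * (p * (a - b)) :=
      mul_le_mul_of_nonneg_left (by linarith) hm.le
    have h5 : m * (p * (a - b)) = p * (c - 1) := by
      have : m * (p * (a - b)) = p * (m * a - m * b) := by ring
      rw [this, hma, hmb]; ring
    linarith
  have jensen : n * ((n - 1 + β) / n) ^ p ≤ n - 1 + A := by
    have h1s : (1 : ℝ) ∈ Set.Ici (0 : ℝ) := by simp
    have hβs : β ∈ Set.Ici (0 : ℝ) := hβ0
    have hw1 : 0 ≤ (n - 1) / n := div_nonneg (by linarith) hn0.le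
    have hw2 : 0 ≤ 1 / n := by positivity
    have hw : (n - 1) / n + 1 / n = 1 := by field_simp; ring
    have h := (convexOn_rpow hp.le).2 h1s hβs hw1 hw2 hw
    simp only [smul_eq_mul, Real.one_rpow, hβp] at h
    have e1 : (n - 1) / n * 1 + 1 / n * β = (n - 1 + β) / n := by ring
    have e2 : (n - 1) / n * 1 + 1 / n * A = (n - 1 + A) / n := by ring
    rw [e1, e2, le_div_iff₀ hn0] at h
    linarith
  have hs0 : 0 ≤ n - 1 + β := by linarith
  have hc0 : 0 < c := by linarith
  have step2 : (t - c) ^ p / m ^ (p - 1) ≤ c ^ p * (n - 1 + A) := by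
    calc (t - c) ^ p / m ^ (p - 1) ≤ (c * (n - 1 + β)) ^ p / n ^ (p - 1) := by
          have : t - c ≤ c * (n - 1 + β) := by
            rw [← hcD, hD]; nlinarith
          have h0 : 0 ≤ t - c := by linarith
          have hp1 : 0 ≤ p - 1 := by linarith
          gcongr
      _ = c ^ p * (n * ((n - 1 + β) / n) ^ p) := by
          rw [← key _ _ hs0 hn0, Real.mul_rpow hc0.le hs0]; ring
      _ ≤ _ := by gcongr
  have : c ^ p * D = c ^ p + c ^ p * (n - 1 + A) := by rw [hD]; ring
  linarith

theorem convex_hull_bound_ge_union_bound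
    (d : ℕ) (hd : 2 ≤ d) (ε1 εinf : ℝ) (hε1 : 0 < ε1) (hεinf : 0 < εinf)
    (h1 : εinf < ε1) (h2 : ε1 < d * εinf)
    (p q : ℝ) (hp : 1 < p) (hpq : 1 / p + 1 / q = 1)
    (α : ℝ) (hα : α = ε1 / εinf - ⌊ε1 / εinf⌋) :
    ε1 / (ε1 / εinf - α + α ^ q) ^ (1 / q) ≥
      (εinf ^ p + (ε1 - εinf) ^ p / ((d : ℝ) - 1) ^ (p - 1)) ^ (1 / p) := by
  have hp0 : 0 < p := by linarith
  have hiq : 1 / q = 1 - 1 / p := by linarith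
  have hip : 1 / p < 1 := by rw [div_lt_one hp0]; exact hp
  have hip0 : 0 < 1 / p := by positivity
  have hq0 : 0 < q := by
    have : 0 < 1 / q := by linarith
    exact one_div_pos.mp this
  have hq : 1 < q := by
    have : 1 / q < 1 := by linarith
    rwa [div_lt_one hq0] at this
  have hpq' : (q - 1) * p = q := by field_simp at hpq; linarith
  have hqp : 1 / q * p = p - 1 := by rw [hiq]; field_simp
  obtain ⟨t, ht⟩ : ∃ t, t = ε1 / εinf := ⟨_, rfl⟩
  have hte : ε1 = εinf * t := by rw [ht]; field_simp
  have ht1 : 1 < t := by rw [ht, one_lt_div hεinf]; exact h1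
  have htd : t < d := by rw [ht, div_lt_iff₀ hεinf]; exact h2
  rw [← ht] at hα ⊢
  have hfl := Int.floor_le t
  have hfl2 := Int.lt_floor_add_one t
  have hn1 : (1 : ℝ) ≤ (⌊t⌋ : ℝ) := by
    exact_mod_cast Int.le_floor.mpr (by exact_mod_cast ht1.le)
  have hnd : (⌊t⌋ : ℝ) ≤ (d : ℝ) - 1 := by
    have : ⌊t⌋ < (d : ℤ) := Int.floor_lt.mpr (by exact_mod_cast htd)
    have : ⌊t⌋ + 1 ≤ (d : ℤ) := this
    have : (⌊t⌋ : ℝ) + 1 ≤ (d : ℝ) := by exact_mod_cast this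
    linarith
  have hnα : (⌊t⌋ : ℝ) + α = t := by rw [hα]; ring
  have hn : t - α = (⌊t⌋ : ℝ) := by rw [hα]; ring
  have hα0 : 0 ≤ α := by linarith
  have core := aux_core (⌊t⌋ : ℝ) ((d : ℝ) - 1) α p q hn1 hnd hα0 (by linarith)
    (by linarith) (by linarith) hp hq hpq'
  rw [hnα] at core
  rw [hn]
  have hA0 : 0 ≤ α ^ q := Real.rpow_nonneg hα0 _
  set D := (⌊t⌋ : ℝ) + α ^ q with hD
  have hD0 : 0 < D := by linarith
  have ht0 : 0 < t := by linarith
  have hm0 : 0 < (d : ℝ) - 1 := by linarith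
  have hy : 0 ≤ ε1 / D ^ (1 / q) := by positivity
  have main : εinf ^ p + (ε1 - εinf) ^ p / ((d : ℝ) - 1) ^ (p - 1) ≤ (ε1 / D ^ (1 / q)) ^ p := by
    have e1 : ε1 - εinf = εinf * (t - 1) := by rw [hte]; ring
    have e2 : (ε1 / D ^ (1 / q)) ^ p = εinf ^ p * ((t / D) ^ p * D) := by
      rw [Real.div_rpow hε1.le (by positivity), ← Real.rpow_mul hD0.le, hqp, hte,
        Real.mul_rpow hεinf.le ht0.le, Real.div_rpow ht0.le hD0.le, Real.rpow_sub_one hD0.ne']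
      field_simp
    rw [e2, e1, Real.mul_rpow hεinf.le (by linarith)]
    calc _ = εinf ^ p * (1 + (t - 1) ^ p / ((d : ℝ) - 1) ^ (p - 1)) := by ring
      _ ≤ _ := by gcongr
  have hx : 0 ≤ εinf ^ p + (ε1 - εinf) ^ p / ((d : ℝ) - 1) ^ (p - 1) := by
    have : 0 ≤ ε1 - εinf := by linarith
    positivity
  have := Real.rpow_le_rpow hx main hip0.le
  rwa [← Real.rpow_mul hy, mul_one_div_cancel hp0.ne', Real.rpow_one] at this
end
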